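/- For every real x > 0, F(x) + F′(x) = 2 F(2x), where F′ denotes the derivative of F. -/

import Mathlib

open Filter Real

/-- `Q j = ∏_{ℓ=1}^{j} (1 - 2^{-ℓ})`. -/
noncomputable def Q (j : ℕ) : ℝ := ∏ l ∈ Finset.range j, (1 - (2:ℝ)^(-(l:ℤ)-1))

/-- `Q_∞ = ∏_{ℓ≥1} (1 - 2^{-ℓ})`. -/
noncomputable def Qinf : ℝ := ∏' l : ℕ, (1 - (2:ℝ)^(-(l:ℤ)-1))

/-- `F(x) = ∑_{j≥0} (-1)^j 2^{-j(j-1)/2} e^{-2^j x} / (Q_j Q_∞)`. -/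
noncomputable def F (x : ℝ) : ℝ :=
  ∑' j : ℕ, (-1:ℝ)^j * ((2:ℝ)^(j.choose 2))⁻¹ * Real.exp (-(2:ℝ)^j * x) / (Q j * Qinf)

noncomputable def cF (j : ℕ) : ℝ := (-1:ℝ)^j * ((2:ℝ)^(j.choose 2))⁻¹ / (Q j * Qinf)

theorem zpow_aux (l : ℕ) : (2:ℝ)^(-(l:ℤ)-1) = (2^(l+1))⁻¹ := by
  have : (-(l:ℤ)-1) = -((l+1 : ℕ):ℤ) := by push_cast; ring
  rw [this, zpow_neg, zpow_natCast]

theorem Q_succ (j : ℕ) : Q (j+1) = Q j * (1 - (2^(j+1))⁻¹) := by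
  unfold Q
  rw [Finset.prod_range_succ, zpow_aux]

theorem Q_lower (j : ℕ) : ((2:ℝ)^j)⁻¹ ≤ Q j := by
  induction j with
  | zero => simp [Q]
  | succ j ih =>
    rw [Q_succ, pow_succ, mul_inv]
    have h1 : (1:ℝ) ≤ 2^j := one_le_pow₀ (by norm_num)
    have h2 : ((2:ℝ)^j)⁻¹ ≤ 1 := inv_le_one_of_one_le₀ h1
    have h3 : (0:ℝ) < ((2:ℝ)^j)⁻¹ := by positivity
    apply mul_le_mul ih _ (by norm_num) (h3.le.trans ih)
    linarith

theorem Q_pos (j : ℕ) : 0 < Q j := lt_of_lt_of_le (by positivity) (Q_lower j)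

theorem cF_bound (j : ℕ) : |cF j| ≤ 2^j * |Qinf|⁻¹ := by
  have h1 : |cF j| = ((2:ℝ)^(j.choose 2))⁻¹ * (Q j)⁻¹ * |Qinf|⁻¹ := by
    unfold cF
    rw [abs_div, abs_mul, abs_mul, abs_pow, abs_neg, abs_one, one_pow, one_mul,
      abs_of_pos (Q_pos j), abs_of_pos (by positivity : (0:ℝ) < ((2:ℝ)^(j.choose 2))⁻¹),
      div_eq_mul_inv, mul_inv, mul_assoc]
  rw [h1]
  have h2 : ((2:ℝ)^(j.choose 2))⁻¹ ≤ 1 := inv_le_one_of_one_le₀ (one_le_pow₀ (by norm_num))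
  have h3 : (Q j)⁻¹ ≤ 2^j := inv_le_of_inv_le₀ (by positivity) (Q_lower j)
  have h4 : 0 < (Q j)⁻¹ := inv_pos.2 (Q_pos j)
  apply mul_le_mul_of_nonneg_right _ (by positivity)
  calc _ ≤ 1 * (Q j)⁻¹ := mul_le_mul_of_nonneg_right h2 h4.le
    _ ≤ _ := by rw [one_mul]; exact h3

theorem term_bound (a y : ℝ) (ha : 0 < a) (hy : a < y) (j : ℕ) :
    ‖cF j * (-(2:ℝ)^j) * Real.exp (-(2:ℝ)^j * y)‖ ≤ (|Qinf|⁻¹ * 6 / a^3) * (1/2)^j := by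
  have h2 : (0:ℝ) < 2^j := by positivity
  have he : Real.exp (-(2:ℝ)^j * y) ≤ 6 / ((2:ℝ)^j * a)^3 := by
    have h := Real.pow_div_factorial_le_exp ((2:ℝ)^j * a) (by positivity) 3
    have h' : Real.exp ((2:ℝ)^j * a) ≤ Real.exp ((2:ℝ)^j * y) :=
      Real.exp_le_exp.2 (mul_le_mul_of_nonneg_left hy.le h2.le)
    rw [neg_mul, Real.exp_neg]
    apply inv_le_of_inv_le₀ (by positivity)
    rw [inv_div]
    norm_num [Nat.factorial] at h ⊢
    linarith
  rw [Real.norm_eq_abs, abs_mul, abs_mul, abs_neg, abs_of_pos h2, abs_of_pos (Real.exp_pos _)]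
  calc _ ≤ (2^j * |Qinf|⁻¹) * 2^j * (6 / ((2:ℝ)^j * a)^3) := by
        gcongr
        exact cF_bound j
    _ = _ := by
        rw [one_div, inv_pow]
        field_simp

theorem cF_succ (j : ℕ) : cF (j+1) * (1 - 2^(j+1)) = 2 * cF j := by
  unfold cF
  rw [Q_succ, Nat.choose_succ_succ' j 1, Nat.choose_one_right, pow_add (2:ℝ), pow_succ (-1:ℝ)]
  have hQ := (Q_pos j).ne'
  have h1 : (1:ℝ) < 2^(j+1) := one_lt_pow₀ (by norm_num) (by omega)
  have h3 : (2:ℝ)^(j+1) - 1 ≠ 0 := by linarith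
  have h4 : 1 - ((2:ℝ)^(j+1))⁻¹ = (2^(j+1) - 1) / 2^(j+1) := by field_simp
  rw [h4]
  by_cases hq : Qinf = 0
  · simp [hq]
  field_simp
  ring

theorem F_eq (x : ℝ) : F x = ∑' j : ℕ, cF j * Real.exp (-(2:ℝ)^j * x) := by
  unfold F cF
  congr 1
  ext j
  ring

/-- The differential-functional equation `F(x) + F′(x) = 2F(2x)` for `x > 0`. -/
theorem F_functional_equation : ∀ x : ℝ, 0 < x → F x + deriv F x = 2 * F (2 * x) := by
  intro x hx
  have ha : 0 < x / 2 := by linarith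
  have hu : Summable fun j : ℕ => (|Qinf|⁻¹ * 6 / (x/2)^3) * (1/2:ℝ)^j :=
    (summable_geometric_of_lt_one (by norm_num) (by norm_num)).mul_left _
  have hs' : Summable fun j : ℕ => cF j * (-(2:ℝ)^j) * Real.exp (-(2:ℝ)^j * x) :=
    Summable.of_norm_bounded hu fun j => term_bound (x/2) x ha (by linarith) j
  have hs : Summable fun j : ℕ => cF j * Real.exp (-(2:ℝ)^j * x) := by
    refine Summable.of_norm_bounded hs'.norm fun j => ?_
    rw [norm_mul, norm_mul, norm_mul, norm_neg, norm_pow, Real.norm_ofNat]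
    have h1 : (1:ℝ) ≤ 2^j := one_le_pow₀ (by norm_num)
    apply mul_le_mul_of_nonneg_right _ (norm_nonneg _)
    exact le_mul_of_one_le_right (norm_nonneg _) h1
  have hd : HasDerivAt F (∑' j : ℕ, cF j * (-(2:ℝ)^j) * Real.exp (-(2:ℝ)^j * x)) x := by
    rw [show F = _ from funext F_eq]
    refine hasDerivAt_tsum_of_isPreconnected (t := Set.Ioi (x/2)) (y₀ := x) hu isOpen_Ioi
      isPreconnected_Ioi ?_ (fun j y hy => term_bound (x/2) y ha hy j) ?_ hs ?_
    · intro j y _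
      have h := (((hasDerivAt_id y).const_mul (-(2:ℝ)^j)).exp).const_mul (cF j)
      have e : cF j * (-(2:ℝ)^j) * Real.exp (-(2:ℝ)^j * y)
          = cF j * (Real.exp (-(2:ℝ)^j * id y) * (-(2:ℝ)^j * 1)) := by
        simp only [id]
        ring
      rw [e]
      exact h
    · simp only [Set.mem_Ioi]; linarith
    · simp only [Set.mem_Ioi]; linarith
  rw [hd.deriv, F_eq, F_eq, ← hs.tsum_add hs', (hs.add hs').tsum_eq_zero_add, ← tsum_mul_left]
  simp only [pow_zero, mul_neg, mul_one, neg_mul, add_neg_cancel, zero_add]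
  congr 1
  ext j
  have h := cF_succ j
  have he : (2:ℝ)^j * (2 * x) = 2^(j+1) * x := by ring
  rw [he, ← mul_assoc, ← h]
  ring
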